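/- arXiv:1005.1424 — 2 statements merged into one kernel-verified Lean document; each statement's English description precedes it below -/
import Mathlib

section
/- Let A : Matrix n n ℝ≥0 and let K = { X ⊗ u | u : m → ℝ≥0 } be the finitely generated max cone generated by the columns of a matrix X : Matrix n m ℝ≥0 (n, m finite types). Assume K is nontrivial (there exists u with X ⊗ u ≠ 0) and that A maps K into itself (for every u : m → ℝ≥0 there exists w : m → ℝ≥0 with A ⊗ (X ⊗ u) = X ⊗ w). Then A has an eigenvector in K: there exist u : m → ℝ≥0 and α : ℝ≥0 such that v := X ⊗ u satisfies v ≠ 0 and A ⊗ v = α • v. -/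
open scoped NNReal

/-- Max-algebraic action of a matrix on a vector over ℝ≥0. -/
noncomputable def maxVec {l m : Type*} [Fintype m]
    (A : Matrix l m ℝ≥0) (v : m → ℝ≥0) : l → ℝ≥0 :=
  fun i => ⨆ j, A i j * v j

/-- The iterates of a continuous monotone map starting from a supersolution decrease to a fixed
point. -/
theorem exists_fixedPoint_tendsto_iterate {n : Type*} {F : (n → ℝ≥0) → n → ℝ≥0}
    (hF : Continuous F) (hmono : Monotone F) {w : n → ℝ≥0} (hw : F w ≤ w) :
    ∃ v, F v = v ∧ Filter.Tendsto (fun k => F^[k] w) Filter.atTop (nhds v) := by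
  have hlim : Filter.Tendsto (fun k => F^[k] w) Filter.atTop (nhds fun i => ⨅ k, F^[k] w i) :=
    tendsto_pi_nhds.2 fun i => tendsto_atTop_ciInf
      (fun _ _ h => hmono.antitone_iterate_of_map_le hw h i) (OrderBot.bddBelow _)
  exact ⟨_, isFixedPt_of_tendsto_iterate hlim hF.continuousAt, hlim⟩

section MaxVec

variable {l m n : Type*} [Fintype m] [Fintype n]

theorem maxVec_apply_le_iff {A : Matrix l m ℝ≥0} {v : m → ℝ≥0} {i : l} {c : ℝ≥0} :
    maxVec A v i ≤ c ↔ ∀ j, A i j * v j ≤ c :=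
  ciSup_le_iff' (Set.finite_range _).bddAbove

theorem le_maxVec (A : Matrix l m ℝ≥0) (v : m → ℝ≥0) (i : l) (j : m) :
    A i j * v j ≤ maxVec A v i :=
  maxVec_apply_le_iff.1 le_rfl j

theorem maxVec_mono (A : Matrix l m ℝ≥0) : Monotone (maxVec A) := fun _ v h i =>
  maxVec_apply_le_iff.2 fun j => (mul_le_mul_right (h j) _).trans (le_maxVec A v i j)

theorem maxVec_smul (A : Matrix l m ℝ≥0) (c : ℝ≥0) (v : m → ℝ≥0) :
    maxVec A (c • v) = c • maxVec A v := by
  ext1 i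
  simp only [maxVec, Pi.smul_apply, smul_eq_mul, NNReal.mul_iSup, mul_left_comm]

theorem smul_maxVec (c : ℝ≥0) (A : Matrix l m ℝ≥0) (v : m → ℝ≥0) :
    maxVec (c • A) v = c • maxVec A v := by
  ext1 i
  simp only [maxVec, Pi.smul_apply, Matrix.smul_apply, smul_eq_mul, NNReal.mul_iSup, mul_assoc]

theorem maxVec_eq_sup (A : Matrix l m ℝ≥0) (v : m → ℝ≥0) (i : l) :
    maxVec A v i = Finset.univ.sup fun j => A i j * v j :=
  eq_of_forall_ge_iff fun c => by simp [maxVec_apply_le_iff]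

theorem continuous_maxVec (A : Matrix l m ℝ≥0) : Continuous (maxVec A) := by
  refine continuous_pi fun i => ?_
  simp only [maxVec_eq_sup]
  exact Continuous.finset_sup_apply (s := Finset.univ) (f := fun j (v : m → ℝ≥0) => A i j * v j)
    (by fun_prop)

theorem maxVec_maxVec (A : Matrix l m ℝ≥0) (B : Matrix m n ℝ≥0) (u : n → ℝ≥0) :
    maxVec A (maxVec B u) =
      maxVec (Matrix.of fun i k => maxVec A (fun j => B j k) i) u := by
  ext1 i
  refine eq_of_forall_ge_iff fun c => ?_
  have h₁ (j : m) : A i j * maxVec B u j ≤ c ↔ ∀ k, A i j * (B j k * u k) ≤ c := by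
    rw [maxVec, NNReal.mul_iSup]
    exact ciSup_le_iff' (Set.finite_range _).bddAbove
  have h₂ (k : n) : maxVec A (fun j => B j k) i * u k ≤ c ↔
      ∀ j, A i j * B j k * u k ≤ c := by
    rw [maxVec, NNReal.iSup_mul]
    exact ciSup_le_iff' (Set.finite_range _).bddAbove
  rw [maxVec_apply_le_iff, maxVec_apply_le_iff]
  simp only [Matrix.of_apply, h₁, h₂, mul_assoc]
  exact forall_comm

/-- If `T` has a positive subinvariant vector, then either it has a nonzero invariant vector or
some multiple `c • T` with `1 < c` still has a positive subinvariant vector. -/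
theorem exists_invariant_or_exists_smul_subinvariant (T : Matrix n n ℝ≥0) {u : n → ℝ≥0}
    (hpos : ∀ i, 0 < u i) (hu : maxVec T u ≤ u) :
    (∃ v, v ≠ 0 ∧ maxVec T v = v) ∨
      ∃ c : ℝ≥0, 1 < c ∧ ∃ w : n → ℝ≥0, (∀ i, 0 < w i) ∧ maxVec (c • T) w ≤ w := by
  obtain ⟨v, hv, hlim⟩ :=
    exists_fixedPoint_tendsto_iterate (continuous_maxVec T) (maxVec_mono T) hu
  by_cases hv0 : v ≠ 0
  · exact .inl ⟨v, hv0, hv⟩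
  obtain rfl : v = 0 := not_not.1 hv0
  right
  have hev : ∀ᶠ k in Filter.atTop, ∀ i, (maxVec T)^[k] u i < 2⁻¹ * u i :=
    Filter.eventually_all.2 fun i =>
      (tendsto_pi_nhds.1 hlim i).eventually_lt_const (mul_pos (by norm_num) (hpos i))
  obtain ⟨k, hk, hk0⟩ := (hev.and (Filter.eventually_ne_atTop 0)).exists
  set c : ℝ≥0 := 2 ^ (k⁻¹ : ℝ)
  have hck : c ^ k = 2 := NNReal.rpow_inv_natCast_pow 2 hk0
  have hc1 : 1 < c := by
    rw [← one_lt_pow_iff_of_nonneg zero_le hk0, hck]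
    norm_num
  have hiter (j : ℕ) : (maxVec (c • T))^[j] u = c ^ j • (maxVec T)^[j] u := by
    induction j with
    | zero => simp
    | succ j ih =>
      rw [Function.iterate_succ_apply', ih, smul_maxVec, maxVec_smul, smul_smul, ← pow_succ',
        Function.iterate_succ_apply']
  have hle (j : ℕ) (hj : j < k) (i : n) :
      (maxVec (c • T))^[j] u i ≤ (Finset.range k).sup fun j => (maxVec (c • T))^[j] u i :=
    Finset.le_sup (f := fun j => (maxVec (c • T))^[j] u i) (Finset.mem_range.2 hj)
  refine ⟨c, hc1, fun i => (Finset.range k).sup fun j => (maxVec (c • T))^[j] u i,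
    fun i => (hpos i).trans_le (hle 0 (Nat.pos_of_ne_zero hk0) i), fun i => ?_⟩
  refine maxVec_apply_le_iff.2 fun i' => ?_
  rw [NNReal.mul_finset_sup]
  refine Finset.sup_le fun j hj => (le_maxVec _ _ i i').trans ?_
  rw [← Function.iterate_succ_apply' (maxVec (c • T))]
  obtain h | h := (Nat.succ_le_of_lt (Finset.mem_range.1 hj)).lt_or_eq
  · exact hle _ h i
  · refine le_trans ?_ (hle 0 (Nat.pos_of_ne_zero hk0) i)
    rw [h, hiter, hck, Pi.smul_apply, smul_eq_mul]
    refine (mul_le_mul_right (hk i).le 2).trans_eq ?_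
    rw [mul_inv_cancel_left₀ two_ne_zero, Function.iterate_zero_apply]

/-- A positive subeigenvector yields a normalized solution of the resolvent equation. -/
theorem exists_resolvent_of_subeigenvector [Nonempty n] (W : Matrix n n ℝ≥0) {c : ℝ≥0}
    (hc : 0 < c) {u : n → ℝ≥0} (hpos : ∀ i, 0 < u i) (hu : maxVec W u ≤ c • u) :
    ∃ (s : ℝ≥0) (v : n → ℝ≥0), s ≤ 1 ∧ v ≤ 1 ∧ (∃ i, v i = 1) ∧
      c • v = (fun _ => c * s) ⊔ maxVec W v := by
  obtain ⟨i₀, hi₀⟩ := Finite.exists_min u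
  have hF : Continuous fun x => (1 : n → ℝ≥0) ⊔ c⁻¹ • maxVec W x :=
    continuous_pi fun i => continuous_const.max
      (continuous_const.mul ((continuous_apply i).comp (continuous_maxVec W)))
  have hFm : Monotone fun x => (1 : n → ℝ≥0) ⊔ c⁻¹ • maxVec W x := fun x y h =>
    sup_le_sup_left (fun i => mul_le_mul_right (maxVec_mono W h i) _) _
  have hw : (1 : n → ℝ≥0) ⊔ c⁻¹ • maxVec W ((u i₀)⁻¹ • u) ≤ (u i₀)⁻¹ • u := by
    refine sup_le (fun i => ?_) (fun i => ?_)
    · change 1 ≤ (u i₀)⁻¹ * u i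
      rw [← inv_mul_cancel₀ (hpos i₀).ne']
      exact mul_le_mul_right (hi₀ i) _
    · rw [maxVec_smul]
      change c⁻¹ * ((u i₀)⁻¹ * maxVec W u i) ≤ (u i₀)⁻¹ * u i
      rw [mul_left_comm]
      refine mul_le_mul_right ?_ _
      rw [inv_mul_le_iff₀ hc]
      exact hu i
  obtain ⟨v, hv, -⟩ := exists_fixedPoint_tendsto_iterate hF hFm hw
  have hv1 : 1 ≤ v := le_sup_left.trans_eq hv
  obtain ⟨i₁, hi₁⟩ := Finite.exists_max v
  have hN : 0 < v i₁ := one_pos.trans_le (hv1 i₁)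
  refine ⟨(v i₁)⁻¹, (v i₁)⁻¹ • v, inv_le_one_of_one_le₀ (hv1 i₁), fun i => ?_,
    ⟨i₁, inv_mul_cancel₀ hN.ne'⟩, ?_⟩
  · change (v i₁)⁻¹ * v i ≤ 1
    rw [inv_mul_le_iff₀ hN, mul_one]
    exact hi₁ i
  · ext1 i
    have hvi : max 1 (c⁻¹ * maxVec W v i) = v i := congrFun hv i
    rw [maxVec_smul]
    change c * ((v i₁)⁻¹ * v i) = max (c * (v i₁)⁻¹) ((v i₁)⁻¹ * maxVec W v i)
    rw [← hvi, ← mul_assoc, mul_max, mul_one]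
    congr 1
    field_simp

/-- Every nonempty square matrix has a max-algebraic eigenvector. -/
theorem exists_maxVec_eigenvector [Nonempty n] (W : Matrix n n ℝ≥0) :
    ∃ (v : n → ℝ≥0) (c : ℝ≥0), v ≠ 0 ∧ maxVec W v = c • v := by
  set C : ℝ≥0 := 1 + Finset.univ.sup (maxVec W 1)
  have hsub : maxVec W 1 ≤ C • (1 : n → ℝ≥0) := fun i => by
    simpa using (Finset.le_sup (Finset.mem_univ i)).trans (le_add_of_nonneg_left zero_le_one)
  let K : Set (ℝ≥0 × ℝ≥0 × (n → ℝ≥0)) := Set.Icc 0 (C, 1, 1) ∩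
    ({p | ∃ i, p.2.2 i = 1} ∩ {p | p.1 • p.2.2 = (fun _ => p.1 * p.2.1) ⊔ maxVec W p.2.2})
  have hK : IsCompact K := by
    refine isCompact_Icc.inter_right (IsClosed.inter ?_ ?_)
    · rw [Set.ofPred_exists]
      exact isClosed_iUnion_of_finite fun i => isClosed_eq (by fun_prop) continuous_const
    · refine isClosed_eq (by fun_prop) (continuous_pi fun i => Continuous.max (by fun_prop) ?_)
      exact (continuous_apply i).comp ((continuous_maxVec W).comp (by fun_prop))
  have hmem {c : ℝ≥0} (hc : 0 < c) (hcC : c ≤ C) {u : n → ℝ≥0} (hpos : ∀ i, 0 < u i)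
      (hu : maxVec W u ≤ c • u) : ∃ p ∈ K, p.1 = c := by
    obtain ⟨s, v, hs, hv, hone, heq⟩ := exists_resolvent_of_subeigenvector W hc hpos hu
    exact ⟨(c, s, v), ⟨⟨⟨zero_le, zero_le, fun _ => zero_le⟩, hcC, hs, hv⟩, hone, heq⟩, rfl⟩
  obtain ⟨p₀, hp₀, -⟩ := hmem (by positivity) le_rfl (fun _ => one_pos) hsub
  obtain ⟨⟨c, s, v⟩, ⟨⟨-, hcC, -⟩, ⟨i, hi⟩, heq⟩, hmin⟩ :=
    hK.exists_isMinOn ⟨p₀, hp₀⟩ continuous_fst.continuousOn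
  change c • v = (fun _ => c * s) ⊔ maxVec W v at heq
  change v i = 1 at hi
  change c ≤ C at hcC
  obtain h0 | hcs := (zero_le (a := c * s)).eq_or_lt
  · refine ⟨v, c, fun h => by simp [h] at hi, ?_⟩
    rw [heq, ← h0]
    exact (sup_eq_right.2 fun _ => zero_le).symm
  have hc : 0 < c := pos_of_mul_pos_left hcs zero_le
  have hpos (i : n) : 0 < v i := by
    have : c * s ≤ c * v i := (le_sup_left.trans_eq heq.symm : (fun _ => c * s) ≤ c • v) i
    exact pos_of_mul_pos_right (hcs.trans_le this) zero_le
  have hT : maxVec (c⁻¹ • W) v ≤ v := fun i => by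
    rw [smul_maxVec, Pi.smul_apply, smul_eq_mul, inv_mul_le_iff₀ hc]
    exact (le_sup_right.trans_eq heq.symm : maxVec W v ≤ c • v) i
  obtain ⟨w, hw0, hw⟩ | ⟨d, hd, w, hw0, hw⟩ :=
    exists_invariant_or_exists_smul_subinvariant _ hpos hT
  · refine ⟨w, c, hw0, ?_⟩
    rw [smul_maxVec] at hw
    nth_rw 2 [← hw]
    rw [smul_inv_smul₀ hc.ne']
  · have hd0 : 0 < d := one_pos.trans hd
    have hlt : c * d⁻¹ < c := mul_lt_of_lt_one_right hc (inv_lt_one_of_one_lt₀ hd)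
    obtain ⟨p, hp, hpc⟩ := hmem (c := c * d⁻¹) (by positivity) (hlt.le.trans hcC) hw0 fun i => by
      have := hw i
      rw [smul_smul, smul_maxVec, Pi.smul_apply, smul_eq_mul] at this
      rw [Pi.smul_apply, smul_eq_mul, ← inv_mul_le_iff₀ (by positivity)]
      rwa [mul_inv, inv_inv, mul_comm c⁻¹]
    exact absurd (hmin hp) (by simpa [hpc] using hlt)

end MaxVec

theorem eigenvector_in_invariant_cone {n m : Type*} [Fintype n] [Fintype m]
    (A : Matrix n n ℝ≥0) (X : Matrix n m ℝ≥0)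
    (hnontriv : ∃ u : m → ℝ≥0, maxVec X u ≠ 0)
    (hinv : ∀ u : m → ℝ≥0, ∃ w : m → ℝ≥0, maxVec A (maxVec X u) = maxVec X w) :
    ∃ (u : m → ℝ≥0) (α : ℝ≥0),
      maxVec X u ≠ 0 ∧ maxVec A (maxVec X u) = α • (maxVec X u) := by
  classical
  let M := {j : m // ∃ i, X i j ≠ 0}
  let Y : Matrix n M ℝ≥0 := Matrix.of fun i j => X i j
  have hrestrict (u : m → ℝ≥0) : maxVec X u = maxVec Y fun j => u j := by
    ext1 i
    refine le_antisymm (maxVec_apply_le_iff.2 fun j => ?_)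
      (maxVec_apply_le_iff.2 fun j => le_maxVec X u i j)
    by_cases hj : ∃ i, X i j ≠ 0
    · exact le_maxVec Y (fun j => u j) i ⟨j, hj⟩
    · push Not at hj
      simp [hj]
  have : Nonempty M := by
    obtain ⟨u, hu⟩ := hnontriv
    by_contra hM
    rw [not_nonempty_iff] at hM
    refine hu ?_
    rw [hrestrict]
    ext1 i
    simp [maxVec]
  have hcol (j : M) : (fun i => Y i j) = maxVec X (Pi.single j.1 1) := by
    ext1 i
    refine le_antisymm (by simpa [Y] using le_maxVec X (Pi.single j.1 1) i j.1)
      (maxVec_apply_le_iff.2 fun k => ?_)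
    obtain rfl | hk := eq_or_ne k j.1
    · simp [Y]
    · simp [hk]
  choose w hw using fun j : M => hinv (Pi.single j.1 1)
  obtain ⟨v, c, hv0, hv⟩ := exists_maxVec_eigenvector (Matrix.of fun i j : M => w j i)
  have hext : maxVec X (fun j => if h : ∃ i, X i j ≠ 0 then v ⟨j, h⟩ else 0) = maxVec Y v := by
    rw [hrestrict]
    congr 1
    ext1 j
    exact dif_pos j.2
  refine ⟨fun j => if h : ∃ i, X i j ≠ 0 then v ⟨j, h⟩ else 0, c, ?_, ?_⟩
  · rw [hext]
    obtain ⟨j, hj⟩ := Function.ne_iff.1 hv0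
    obtain ⟨i, hi⟩ := j.2
    exact fun h => mul_ne_zero hi hj (le_zero_iff.1 ((le_maxVec Y v i j).trans_eq (congrFun h i)))
  · rw [hext, ← maxVec_smul, ← hv, maxVec_maxVec, maxVec_maxVec]
    congr 1
    ext i j
    simp only [Matrix.of_apply]
    rw [hcol, hw, hrestrict]
end

section
/- Let A : Fin r → Matrix n n ℝ≥0 be matrices over a finite type n that commute in pairs under the max-product (A i ⊗ A j = A j ⊗ A i for all i, j). Given i₀ : Fin r and an eigenvalue α₀ of A i₀ (there exists v ≠ 0 with A i₀ ⊗ v = α₀ • v), there exist a function α : Fin r → ℝ≥0 with α i₀ = α₀ and a vector u : n → ℝ≥0 with u ≠ 0 such that A i ⊗ u = α i • u for every i : Fin r; in particular all the matrices A i have a common eigenvector. -/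
open scoped NNReal

/-- Max-algebraic product of matrices over ℝ≥0. -/
noncomputable def maxMul {l m p : Type*} [Fintype m]
    (A : Matrix l m ℝ≥0) (B : Matrix m p ℝ≥0) : Matrix l p ℝ≥0 :=
  fun i k => ⨆ j, A i j * B j k

open Filter Topology

section InvariantMaxCone

variable {n ι : Type*}

/-- A continuous self-map of the max-algebraic cone `n → ℝ≥0` that is linear over the
max-times semiring. -/
structure IsMaxLinear (f : (n → ℝ≥0) → n → ℝ≥0) : Prop where
  continuous : Continuous f
  map_sup : ∀ x y, f (x ⊔ y) = f x ⊔ f y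
  map_smul : ∀ (c : ℝ≥0) x, f (c • x) = c • f x

theorem IsMaxLinear.monotone {f : (n → ℝ≥0) → n → ℝ≥0} (hf : IsMaxLinear f) : Monotone f := by
  intro x y hxy
  rw [← sup_eq_right, ← hf.map_sup, sup_eq_right.mpr hxy]

/-- A closed max cone that is mapped into itself by every member of the family `F`. -/
structure IsInvariantMaxCone (F : ι → (n → ℝ≥0) → n → ℝ≥0) (V : Set (n → ℝ≥0)) : Prop where
  isClosed : IsClosed V
  sup_mem : ∀ ⦃x⦄, x ∈ V → ∀ ⦃y⦄, y ∈ V → x ⊔ y ∈ V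
  smul_mem : ∀ (c : ℝ≥0) ⦃x⦄, x ∈ V → c • x ∈ V
  map_mem : ∀ i ⦃x⦄, x ∈ V → F i x ∈ V

namespace IsInvariantMaxCone

variable {F : ι → (n → ℝ≥0) → n → ℝ≥0} {V : Set (n → ℝ≥0)}

theorem sInter {c : Set (Set (n → ℝ≥0))} (h : ∀ V ∈ c, IsInvariantMaxCone F V) :
    IsInvariantMaxCone F (⋂₀ c) where
  isClosed := isClosed_sInter fun V hV => (h V hV).isClosed
  sup_mem _ hx _ hy V hV := (h V hV).sup_mem (hx V hV) (hy V hV)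
  smul_mem a _ hx V hV := (h V hV).smul_mem a (hx V hV)
  map_mem i _ hx V hV := (h V hV).map_mem i (hx V hV)

theorem inter_map_le (hV : IsInvariantMaxCone F V) (hF : ∀ i, IsMaxLinear (F i))
    (hcomm : ∀ i j x, F i (F j x) = F j (F i x)) (i : ι) (c : ℝ≥0) :
    IsInvariantMaxCone F (V ∩ {x | F i x ≤ c • x}) where
  isClosed := hV.isClosed.inter
    (isClosed_le (hF i).continuous (continuous_const_smul c))
  sup_mem x hx y hy := by
    refine ⟨hV.sup_mem hx.1 hy.1, ?_⟩
    rw [Set.mem_ofPred_eq, (hF i).map_sup]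
    exact sup_le (hx.2.trans (smul_le_smul_of_nonneg_left le_sup_left zero_le))
      (hy.2.trans (smul_le_smul_of_nonneg_left le_sup_right zero_le))
  smul_mem a x hx := by
    refine ⟨hV.smul_mem a hx.1, ?_⟩
    rw [Set.mem_ofPred_eq, (hF i).map_smul, smul_comm]
    exact smul_le_smul_of_nonneg_left hx.2 zero_le
  map_mem j x hx := by
    refine ⟨hV.map_mem j hx.1, ?_⟩
    rw [Set.mem_ofPred_eq, hcomm, ← (hF j).map_smul]
    exact (hF j).monotone hx.2

theorem inter_le_map (hV : IsInvariantMaxCone F V) (hF : ∀ i, IsMaxLinear (F i))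
    (hcomm : ∀ i j x, F i (F j x) = F j (F i x)) (i : ι) (c : ℝ≥0) :
    IsInvariantMaxCone F (V ∩ {x | c • x ≤ F i x}) where
  isClosed := hV.isClosed.inter
    (isClosed_le (continuous_const_smul c) (hF i).continuous)
  sup_mem x hx y hy := by
    refine ⟨hV.sup_mem hx.1 hy.1, ?_⟩
    rw [Set.mem_ofPred_eq, (hF i).map_sup]
    have : c • (x ⊔ y) = c • x ⊔ c • y := by
      ext k; simp [mul_max]
    rw [this]
    exact sup_le_sup hx.2 hy.2
  smul_mem a x hx := by
    refine ⟨hV.smul_mem a hx.1, ?_⟩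
    rw [Set.mem_ofPred_eq, (hF i).map_smul, smul_comm]
    exact smul_le_smul_of_nonneg_left hx.2 zero_le
  map_mem j x hx := by
    refine ⟨hV.map_mem j hx.1, ?_⟩
    rw [Set.mem_ofPred_eq, hcomm, ← (hF j).map_smul]
    exact (hF j).monotone hx.2

end IsInvariantMaxCone

theorem sup_univ_smul [Fintype n] (c : ℝ≥0) (x : n → ℝ≥0) :
    Finset.univ.sup (c • x) = c * Finset.univ.sup x := by
  rw [NNReal.mul_finset_sup]; rfl

theorem sup_univ_ne_zero [Fintype n] {x : n → ℝ≥0} (hx : x ≠ 0) : Finset.univ.sup x ≠ 0 := by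
  obtain ⟨i, hi⟩ := Function.ne_iff.mp hx
  have := Finset.le_sup (f := x) (Finset.mem_univ i)
  exact ((pos_iff_ne_zero.mpr hi).trans_le this).ne'

theorem ne_zero_of_sup_univ_eq_one [Fintype n] {x : n → ℝ≥0} (hx : Finset.univ.sup x = 1) :
    x ≠ 0 := by
  rintro rfl
  have : Finset.univ.sup (0 : n → ℝ≥0) = 0 := Finset.sup_bot _
  exact zero_ne_one (this.symm.trans hx)

theorem isCompact_sup_univ_eq_one [Fintype n] :
    IsCompact {x : n → ℝ≥0 | Finset.univ.sup x = 1} := by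
  refine (isCompact_Icc (a := (0 : n → ℝ≥0)) (b := 1)).of_isClosed_subset
    (isClosed_eq (Continuous.finset_sup_apply fun i _ => continuous_apply i)
      continuous_const) ?_
  intro x hx
  exact ⟨zero_le, fun i => (Finset.le_sup (f := x) (Finset.mem_univ i)).trans_eq hx⟩

/-- Compare the normalized partial suprema of `c⁻ᵏ fᵏ x`: if they stay bounded, their limit is
a supersolution, and otherwise the limit of their normalizations is a subsolution. -/
theorem IsInvariantMaxCone.exists_map_le_or_le_map [Fintype n]
    {F : ι → (n → ℝ≥0) → n → ℝ≥0} {V : Set (n → ℝ≥0)}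
    (hV : IsInvariantMaxCone F V) {i : ι} (hf : IsMaxLinear (F i))
    {x : n → ℝ≥0} (hx : x ∈ V) (hx0 : x ≠ 0) {c : ℝ≥0} (hc : c ≠ 0) :
    (∃ y ∈ V, y ≠ 0 ∧ F i y ≤ c • y) ∨ ∃ y ∈ V, y ≠ 0 ∧ c • y ≤ F i y := by
  set T : (n → ℝ≥0) → n → ℝ≥0 := fun y => x ⊔ c⁻¹ • F i y with hT
  have hTmono : Monotone T := fun a b hab =>
    sup_le_sup_left (smul_le_smul_of_nonneg_left (hf.monotone hab) zero_le) _
  have hTcont : Continuous T := continuous_pi fun k =>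
    continuous_const.sup (continuous_const.mul ((continuous_apply k).comp hf.continuous))
  have hcT (y) : c • T y = c • x ⊔ F i y := by
    ext k; simp [hT, mul_max, hc]
  set y : ℕ → n → ℝ≥0 := fun N => T^[N] x with hy
  have hy_succ (N) : y (N + 1) = T (y N) := Function.iterate_succ_apply' T N x
  have hymono : Monotone y := hTmono.monotone_iterate_of_le_map le_sup_left
  have hxy (N) : x ≤ y N := hymono (Nat.zero_le N)
  have hyV (N) : y N ∈ V := by
    induction N with
    | zero => exact hx
    | succ N ih => rw [hy_succ]; exact hV.sup_mem hx (hV.smul_mem _ (hV.map_mem i ih))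
  have hy0 (N) : y N ≠ 0 := fun h => hx0 (le_antisymm (h ▸ hxy N) zero_le)
  set s : ℕ → ℝ≥0 := fun N => Finset.univ.sup (y N) with hs
  have hs0 (N) : s N ≠ 0 := sup_univ_ne_zero (hy0 N)
  by_cases hb : BddAbove (Set.range s)
  · left
    obtain ⟨M, hM⟩ := hb
    have hlim : Tendsto y atTop (𝓝 fun k => ⨆ N, y N k) := by
      refine tendsto_pi_nhds.mpr fun k => tendsto_atTop_ciSup (fun a b h => hymono h k) ⟨M, ?_⟩
      rintro _ ⟨N, rfl⟩
      exact (Finset.le_sup (f := y N) (Finset.mem_univ k)).trans (hM ⟨N, rfl⟩)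
    set z : n → ℝ≥0 := fun k => ⨆ N, y N k
    have hxz : x ≤ z := ge_of_tendsto' hlim hxy
    have hTz : T z = z := by
      refine tendsto_nhds_unique ((hTcont.tendsto z).comp hlim) ?_
      refine (hlim.comp (tendsto_add_atTop_nat 1)).congr fun N => hy_succ N
    refine ⟨z, hV.isClosed.mem_of_tendsto hlim (Eventually.of_forall hyV),
      fun h => hx0 (le_antisymm (h ▸ hxz) zero_le), ?_⟩
    calc F i z ≤ c • T z := hcT z ▸ le_sup_right
      _ = c • z := by rw [hTz]
  · right
    have hsmono : Monotone s := fun a b h => Finset.sup_mono_fun fun k _ => hymono h k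
    have hs_top : Tendsto s atTop atTop := tendsto_atTop_atTop_of_monotone hsmono fun b => by
      by_contra! h
      exact hb ⟨b, by rintro _ ⟨N, rfl⟩; exact (h N).le⟩
    have hs_inv : Tendsto (fun N => (s N)⁻¹) atTop (𝓝 0) := tendsto_inv_atTop_zero.comp hs_top
    obtain ⟨z, hz, φ, hφ, hlim⟩ := (isCompact_sup_univ_eq_one.inter_left hV.isClosed).tendsto_subseq
      (x := fun N => (s N)⁻¹ • y N)
      fun N => ⟨hV.smul_mem _ (hyV N), by
        rw [Set.mem_ofPred_eq, sup_univ_smul]; exact inv_mul_cancel₀ (hs0 N)⟩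
    refine ⟨z, hz.1, ne_zero_of_sup_univ_eq_one hz.2, ?_⟩
    have hle (N) : c • (s N)⁻¹ • y N ≤ (s N)⁻¹ • c • x ⊔ F i ((s N)⁻¹ • y N) := by
      calc c • (s N)⁻¹ • y N = (s N)⁻¹ • c • y N := smul_comm _ _ _
        _ ≤ (s N)⁻¹ • c • T (y N) := by
          rw [← hy_succ]
          exact smul_le_smul_of_nonneg_left
            (smul_le_smul_of_nonneg_left (hymono N.le_succ) zero_le) zero_le
        _ = _ := by
          rw [hcT, hf.map_smul]
          ext k; simp [mul_max]
    have hR : Tendsto (fun N => (s (φ N))⁻¹ • c • x ⊔ F i ((s (φ N))⁻¹ • y (φ N))) atTop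
        (𝓝 ((0 : ℝ≥0) • c • x ⊔ F i z)) :=
      tendsto_pi_nhds.mpr fun k => (tendsto_pi_nhds.mp
        ((hs_inv.comp hφ.tendsto_atTop).smul_const (c • x)) k).sup_nhds
          (tendsto_pi_nhds.mp ((hf.continuous.tendsto z).comp hlim) k)
    have := le_of_tendsto_of_tendsto' (hlim.const_smul c) hR fun N => hle (φ N)
    rw [zero_smul] at this
    exact this.trans_eq (sup_eq_right.mpr zero_le)

theorem IsInvariantMaxCone.exists_minimal [Fintype n]
    {F : ι → (n → ℝ≥0) → n → ℝ≥0} {W : Set (n → ℝ≥0)}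
    (hW : IsInvariantMaxCone F W) (hW0 : ∃ x ∈ W, x ≠ 0) :
    ∃ V ⊆ W, Minimal (fun V => IsInvariantMaxCone F V ∧ ∃ x ∈ V, x ≠ 0) V := by
  refine zorn_superset_nonempty {V | IsInvariantMaxCone F V ∧ ∃ x ∈ V, x ≠ 0} ?_ W ⟨hW, hW0⟩
  intro C hC hchain hne
  refine ⟨⋂₀ C, ⟨.sInter fun V hV => (hC hV).1, ?_⟩, fun V hV => Set.sInter_subset_of_mem hV⟩
  have : Nonempty C := hne.to_subtype
  obtain ⟨x, hx⟩ := IsCompact.nonempty_iInter_of_directed_nonempty_isCompact_isClosed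
    (fun V : C => (V : Set (n → ℝ≥0)) ∩ {x | Finset.univ.sup x = 1})
    (by
      intro U V
      rcases hchain.total U.2 V.2 with h | h
      · exact ⟨U, subset_rfl, Set.inter_subset_inter_left _ h⟩
      · exact ⟨V, Set.inter_subset_inter_left _ h, subset_rfl⟩)
    (by
      intro V
      obtain ⟨hV, x, hx, hx0⟩ := hC V.2
      refine ⟨_, hV.smul_mem (Finset.univ.sup x)⁻¹ hx, ?_⟩
      rw [Set.mem_ofPred_eq, sup_univ_smul]
      exact inv_mul_cancel₀ (sup_univ_ne_zero hx0))
    (fun V => isCompact_sup_univ_eq_one.inter_left (hC V.2).1.isClosed)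
    (fun V => (hC V.2).1.isClosed.inter isCompact_sup_univ_eq_one.isClosed)
  rw [Set.mem_iInter] at hx
  exact ⟨x, fun V hV => (hx ⟨V, hV⟩).1, ne_zero_of_sup_univ_eq_one (hx (Classical.arbitrary C)).2⟩

/-- Commuting max-linear maps act by scalars on every vector of a minimal nonzero invariant
closed max cone. -/
theorem exists_map_eq_smul_of_minimal [Fintype n]
    {F : ι → (n → ℝ≥0) → n → ℝ≥0} {V : Set (n → ℝ≥0)} (hF : ∀ i, IsMaxLinear (F i))
    (hcomm : ∀ i j x, F i (F j x) = F j (F i x))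
    (hV : Minimal (fun V => IsInvariantMaxCone F V ∧ ∃ x ∈ V, x ≠ 0) V)
    {x : n → ℝ≥0} (hx : x ∈ V) (hx0 : x ≠ 0) (i : ι) : ∃ c : ℝ≥0, F i x = c • x := by
  have key {c : ℝ≥0} (hc : c ≠ 0) : F i x ≤ c • x ∨ c • x ≤ F i x := by
    rcases hV.prop.1.exists_map_le_or_le_map (hF i) hx hx0 hc with ⟨y, hy, hy0, h⟩ | ⟨y, hy, hy0, h⟩
    · exact .inl (hV.le_of_le ⟨hV.prop.1.inter_map_le hF hcomm i c, y, ⟨hy, h⟩, hy0⟩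
        Set.inter_subset_left hx).2
    · exact .inr (hV.le_of_le ⟨hV.prop.1.inter_le_map hF hcomm i c, y, ⟨hy, h⟩, hy0⟩
        Set.inter_subset_left hx).2
  set E : Set ℝ≥0 := {c | c • x ≤ F i x} with hE
  have hEclosed : IsClosed E := isClosed_le (continuous_id.smul continuous_const) continuous_const
  have hEne : E.Nonempty := ⟨0, by simp [hE]⟩
  have hEbdd : BddAbove E := by
    obtain ⟨k, hk⟩ := Function.ne_iff.mp hx0
    exact ⟨F i x k / x k, fun c hc => (le_div_iff₀ (pos_iff_ne_zero.mpr hk)).mpr (hc k)⟩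
  refine ⟨sSup E, le_antisymm ?_ (hEclosed.csSup_mem hEne hEbdd)⟩
  have hlim : Tendsto (fun c : ℝ≥0 => c • x) (𝓝[>] sSup E) (𝓝 (sSup E • x)) :=
    ((continuous_id.smul continuous_const).tendsto _).mono_left nhdsWithin_le_nhds
  refine ge_of_tendsto hlim ?_
  filter_upwards [self_mem_nhdsWithin] with c hc
  exact (key (zero_le.trans_lt hc).ne').resolve_right
    fun h => (le_csSup hEbdd h).not_gt hc

end InvariantMaxCone

theorem maxVec_apply_eq_sup {l m : Type*} [Fintype m] (A : Matrix l m ℝ≥0) (v : m → ℝ≥0) (i : l) :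
    maxVec A v i = Finset.univ.sup fun j => A i j * v j :=
  (Finset.sup_univ_eq_ciSup _).symm

theorem maxMul_apply_eq_sup {l m p : Type*} [Fintype m] (A : Matrix l m ℝ≥0)
    (B : Matrix m p ℝ≥0) (i : l) (k : p) :
    maxMul A B i k = Finset.univ.sup fun j => A i j * B j k :=
  (Finset.sup_univ_eq_ciSup _).symm

theorem maxVec_maxVec_s4 {l m p : Type*} [Fintype m] [Fintype p] (A : Matrix l m ℝ≥0)
    (B : Matrix m p ℝ≥0) (v : p → ℝ≥0) : maxVec A (maxVec B v) = maxVec (maxMul A B) v := by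
  ext1 i
  simp_rw [maxVec_apply_eq_sup, maxMul_apply_eq_sup, NNReal.mul_finset_sup, NNReal.finset_sup_mul,
    mul_assoc]
  exact Finset.sup_comm _ _ _

theorem isMaxLinear_maxVec {n : Type*} [Fintype n] (A : Matrix n n ℝ≥0) : IsMaxLinear (maxVec A) where
  continuous := by
    refine continuous_pi fun i => ?_
    simp_rw [maxVec_apply_eq_sup]
    exact Continuous.finset_sup_apply fun j _ => continuous_const.mul (continuous_apply j)
  map_sup x y := by
    ext1 i
    simp_rw [Pi.sup_apply, maxVec_apply_eq_sup, ← Finset.sup_sup, Pi.sup_apply]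
    exact Finset.sup_congr rfl fun j _ => mul_max _ _ _
  map_smul c x := by
    ext1 i
    simp_rw [Pi.smul_apply, maxVec_apply_eq_sup, smul_eq_mul, NNReal.mul_finset_sup, Pi.smul_apply,
      smul_eq_mul, mul_left_comm]

theorem common_eigenvector_of_pairwise_commute {n : Type*} [Fintype n] {r : ℕ}
    (A : Fin r → Matrix n n ℝ≥0)
    (hcomm : ∀ i j : Fin r, maxMul (A i) (A j) = maxMul (A j) (A i))
    (i₀ : Fin r) (α₀ : ℝ≥0)
    (hα₀ : ∃ v : n → ℝ≥0, v ≠ 0 ∧ maxVec (A i₀) v = α₀ • v) :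
    ∃ (α : Fin r → ℝ≥0) (u : n → ℝ≥0),
      α i₀ = α₀ ∧ u ≠ 0 ∧ ∀ i : Fin r, maxVec (A i) u = α i • u := by
  obtain ⟨v, hv0, hv⟩ := hα₀
  have hF (i) := isMaxLinear_maxVec (A i)
  have hcomm' (i j x) : maxVec (A i) (maxVec (A j) x) = maxVec (A j) (maxVec (A i) x) := by
    rw [maxVec_maxVec_s4, maxVec_maxVec_s4, hcomm]
  have huniv : IsInvariantMaxCone (fun i => maxVec (A i)) Set.univ :=
    ⟨isClosed_univ, fun _ _ _ _ => trivial, fun _ _ _ => trivial, fun _ _ _ => trivial⟩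
  have hW := (huniv.inter_map_le hF hcomm' i₀ α₀).inter_le_map hF hcomm' i₀ α₀
  obtain ⟨V, hVW, hV⟩ := hW.exists_minimal ⟨v, ⟨⟨trivial, hv.le⟩, hv.ge⟩, hv0⟩
  obtain ⟨u, hu, hu0⟩ := hV.prop.2
  choose α hα using exists_map_eq_smul_of_minimal hF hcomm' hV hu hu0
  refine ⟨α, u, ?_, hu0, hα⟩
  have h : α i₀ • u = α₀ • u := (hα i₀).symm.trans (le_antisymm (hVW hu).1.2 (hVW hu).2)
  obtain ⟨k, hk⟩ := Function.ne_iff.mp hu0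
  exact mul_right_cancel₀ hk (congrFun h k)
end
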